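/- arXiv:0804.0530 — 4 statements merged into one kernel-verified Lean document; each statement's English description precedes it below -/
import Mathlib

section
/- Let $G$ be a group, $g \in G$ an element whose conjugacy class $\langle g\rangle$ is finite, and $a$ a positive bounded operator on $\ell^2(G)$ belonging to the group von Neumann algebra $\mathcal{N}(G)$. Then the numbers $\mathrm{Tr}^{\langle g\rangle,\mathrm{re}}(a)$ and $\mathrm{Tr}^{\langle g\rangle,\mathrm{im}}(a)$ are real and nonnegative. -/
/-!
STATEMENT 5.  Let `G` be a group, `g ∈ G` with finite conjugacy class `⟨g⟩`, and
`a` a positive bounded operator on `ℓ²(G)` in the group von Neumann algebra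
`𝒩(G)`.  Then `Tr^{⟨g⟩,re}(a)` and `Tr^{⟨g⟩,im}(a)` are real and nonnegative.

Here `tr^ℂ(a) = ⟨a δ_e, δ_e⟩`, `tr^⟨g⟩(a) = ∑_{h ∈ ⟨g⟩} ⟨a δ_e, δ_h⟩`,
`Tr^{⟨g⟩,re}(a) = tr^ℂ(a) + (1/(2|⟨g⟩|)) (tr^⟨g⟩(a) + tr^⟨g⁻¹⟩(a))` and
`Tr^{⟨g⟩,im}(a) = tr^ℂ(a) + (1/(2i|⟨g⟩|)) (tr^⟨g⟩(a) - tr^⟨g⁻¹⟩(a))`.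
"Real and nonnegative" is expressed with the complex order (`0 ≤ z` in `ℂ` means
`z` is real and nonnegative).  We model `ℓ²(G)` as `lp (fun _ : G => ℂ) 2` with
basis vectors `delta g`; membership in `𝒩(G)` is recorded coefficientwise as
commutation with all right translations (`ρ_s δ_h = δ_{h s}`); positivity is
`0 ≤ ⟪ξ, a ξ⟫` for all `ξ`.
-/

open scoped InnerProductSpace ComplexOrder

noncomputable def delta {G : Type*} [Group G] [DecidableEq G] (g : G) :
    lp (fun _ : G => ℂ) 2 :=
  lp.single 2 g 1

/-- The standard trace `tr^ℂ(a) = ⟨a δ_e, δ_e⟩`. -/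
noncomputable def trC {G : Type*} [Group G] [DecidableEq G]
    (a : lp (fun _ : G => ℂ) 2 →L[ℂ] lp (fun _ : G => ℂ) 2) : ℂ :=
  ⟪delta (1 : G), a (delta (1 : G))⟫_ℂ

/-- The delocalized trace `tr^⟨g⟩(a) = ∑_{h ∈ ⟨g⟩} ⟨a δ_e, δ_h⟩`. -/
noncomputable def delocTrace {G : Type*} [Group G] [DecidableEq G] (g : G)
    (a : lp (fun _ : G => ℂ) 2 →L[ℂ] lp (fun _ : G => ℂ) 2) : ℂ :=
  ∑ᶠ h ∈ conjugatesOf g, ⟪delta h, a (delta (1 : G))⟫_ℂ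

/-- `Tr^{⟨g⟩,re}(a) = tr^ℂ(a) + (1/(2|⟨g⟩|)) (tr^⟨g⟩(a) + tr^⟨g⁻¹⟩(a))`. -/
noncomputable def TrRe {G : Type*} [Group G] [DecidableEq G] (g : G)
    (a : lp (fun _ : G => ℂ) 2 →L[ℂ] lp (fun _ : G => ℂ) 2) : ℂ :=
  trC a + (1 / (2 * ((conjugatesOf g).ncard : ℂ))) * (delocTrace g a + delocTrace g⁻¹ a)

/-- `Tr^{⟨g⟩,im}(a) = tr^ℂ(a) + (1/(2i|⟨g⟩|)) (tr^⟨g⟩(a) - tr^⟨g⁻¹⟩(a))`. -/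
noncomputable def TrIm {G : Type*} [Group G] [DecidableEq G] (g : G)
    (a : lp (fun _ : G => ℂ) 2 →L[ℂ] lp (fun _ : G => ℂ) 2) : ℂ :=
  trC a + (1 / (2 * Complex.I * ((conjugatesOf g).ncard : ℂ))) * (delocTrace g a - delocTrace g⁻¹ a)

lemma trC_add_coeff_nonneg {G : Type*} [Group G] [DecidableEq G]
    (a : lp (fun _ : G => ℂ) 2 →L[ℂ] lp (fun _ : G => ℂ) 2)
    (hpos : ∀ ξ : lp (fun _ : G => ℂ) 2, 0 ≤ ⟪ξ, a ξ⟫_ℂ)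
    (hcomm : ∀ s h t : G, ⟪delta t, a (delta (h * s))⟫_ℂ = ⟪delta (t * s⁻¹), a (delta h)⟫_ℂ)
    (w : ℂ) (hw : star w * w = 1) (h : G) :
    0 ≤ 2 * trC a + (star w * ⟪delta h, a (delta (1 : G))⟫_ℂ
      + w * ⟪delta h⁻¹, a (delta (1 : G))⟫_ℂ) := by
  have hdiag : ⟪delta h, a (delta h)⟫_ℂ = trC a := by
    simpa [trC] using hcomm h 1 h
  have hinv : ⟪delta (1 : G), a (delta h)⟫_ℂ = ⟪delta h⁻¹, a (delta (1 : G))⟫_ℂ := by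
    simpa using hcomm h 1 1
  have key := hpos (delta 1 + w • delta h)
  simp only [map_add, map_smul, inner_add_left, inner_add_right, inner_smul_left,
    inner_smul_right, hdiag, hinv, starRingEnd_apply] at key
  refine key.trans_eq ?_
  rw [← trC]
  linear_combination trC a * hw

lemma delocTrace_inv {G : Type*} [Group G] [DecidableEq G] (g : G)
    (a : lp (fun _ : G => ℂ) 2 →L[ℂ] lp (fun _ : G => ℂ) 2) :
    delocTrace g⁻¹ a = ∑ᶠ h ∈ conjugatesOf g, ⟪delta h⁻¹, a (delta (1 : G))⟫_ℂ := by
  have hinv : ∀ x y : G, y ∈ conjugatesOf x → y⁻¹ ∈ conjugatesOf x⁻¹ := by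
    intro x y hy
    obtain ⟨c, rfl⟩ := isConj_iff.1 hy
    exact isConj_iff.2 ⟨c, by group⟩
  refine (finsum_mem_eq_of_bijOn (fun h : G => h⁻¹) ⟨hinv g, inv_injective.injOn, ?_⟩
    fun _ _ => rfl).symm
  intro y hy
  exact ⟨y⁻¹, by simpa using hinv _ _ hy, inv_inv y⟩

lemma trC_add_delocTrace_nonneg {G : Type*} [Group G] [DecidableEq G] (g : G)
    (hfin : (conjugatesOf g).Finite)
    (a : lp (fun _ : G => ℂ) 2 →L[ℂ] lp (fun _ : G => ℂ) 2)
    (hpos : ∀ ξ : lp (fun _ : G => ℂ) 2, 0 ≤ ⟪ξ, a ξ⟫_ℂ)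
    (hcomm : ∀ s h t : G, ⟪delta t, a (delta (h * s))⟫_ℂ = ⟪delta (t * s⁻¹), a (delta h)⟫_ℂ)
    (w : ℂ) (hw : star w * w = 1) :
    0 ≤ trC a + (1 / (2 * ((conjugatesOf g).ncard : ℂ))) *
      (star w * delocTrace g a + w * delocTrace g⁻¹ a) := by
  have hcard : ((conjugatesOf g).ncard : ℂ) ≠ 0 :=
    Nat.cast_ne_zero.2 (Set.ncard_ne_zero_of_mem mem_conjugatesOf_self hfin)
  have hsum := Finset.sum_nonneg fun h (_ : h ∈ hfin.toFinset) =>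
    trC_add_coeff_nonneg a hpos hcomm w hw h
  rw [Finset.sum_add_distrib, Finset.sum_add_distrib, ← Finset.mul_sum, ← Finset.mul_sum,
    ← Finset.mul_sum, Finset.sum_const, ← Set.ncard_eq_toFinset_card _ hfin, nsmul_eq_mul,
    ← finsum_mem_eq_finite_toFinset_sum _ hfin, ← finsum_mem_eq_finite_toFinset_sum _ hfin,
    ← delocTrace_inv, ← delocTrace] at hsum
  have hscale : (0 : ℂ) ≤ 1 / (2 * ((conjugatesOf g).ncard : ℂ)) := by positivity
  refine (mul_nonneg hscale hsum).trans_eq ?_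
  field_simp

theorem statement5 {G : Type*} [Group G] [DecidableEq G] (g : G)
    (hfin : (conjugatesOf g).Finite)
    (a : lp (fun _ : G => ℂ) 2 →L[ℂ] lp (fun _ : G => ℂ) 2)
    (hpos : ∀ ξ : lp (fun _ : G => ℂ) 2, 0 ≤ ⟪ξ, a ξ⟫_ℂ)
    (hcomm : ∀ s h t : G, ⟪delta t, a (delta (h * s))⟫_ℂ = ⟪delta (t * s⁻¹), a (delta h)⟫_ℂ) :
    0 ≤ TrRe g a ∧ 0 ≤ TrIm g a := by
  constructor
  · simpa [TrRe] using trC_add_delocTrace_nonneg g hfin a hpos hcomm 1 (by simp)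
  · refine (trC_add_delocTrace_nonneg g hfin a hpos hcomm Complex.I (by simp)).trans_eq ?_
    have hstar : star Complex.I = -Complex.I := Complex.conj_I
    simp only [TrIm, hstar, one_div, mul_inv, Complex.inv_I]
    ring
end

section
/- Let $G$ be a group, $g \in G$ an element whose conjugacy class $\langle g\rangle$ is finite, and $a$ a positive bounded operator on $\ell^2(G)$ belonging to the group von Neumann algebra $\mathcal{N}(G)$. Then $\mathrm{tr}^{\mathbb{C}}(a) \ge \tfrac{1}{|\langle g\rangle|}\,\big|\mathrm{Re}\big(\mathrm{tr}^{\langle g\rangle}(a)\big)\big|$, and likewise $\mathrm{tr}^{\mathbb{C}}(a) \ge \tfrac{1}{|\langle g\rangle|}\,\big|\mathrm{Im}\big(\mathrm{tr}^{\langle g\rangle}(a)\big)\big|$. -/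
/-!
STATEMENT 6.  Let `G` be a group, `g ∈ G` with finite conjugacy class `⟨g⟩`, and
`a` a positive bounded operator on `ℓ²(G)` in the group von Neumann algebra
`𝒩(G)`.  Then `tr^ℂ(a) ≥ (1/|⟨g⟩|) |Re(tr^⟨g⟩(a))|` and
`tr^ℂ(a) ≥ (1/|⟨g⟩|) |Im(tr^⟨g⟩(a))|`.

Here `tr^ℂ(a) = ⟨a δ_e, δ_e⟩` and `tr^⟨g⟩(a) = ∑_{h ∈ ⟨g⟩} ⟨a δ_e, δ_h⟩`.  The
inequalities are stated in `ℂ` with the complex order (the real right-hand sides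
being coerced to `ℂ`); for a positive operator `tr^ℂ(a)` is indeed a nonnegative
real number.  We model `ℓ²(G)` as `lp (fun _ : G => ℂ) 2` with basis vectors
`delta g`; membership in `𝒩(G)` is recorded coefficientwise as commutation with
all right translations (`ρ_s δ_h = δ_{h s}`); positivity is `0 ≤ ⟪ξ, a ξ⟫` for
all `ξ`.
-/

open scoped InnerProductSpace ComplexOrder

/-- For a positive operator on `ℓ²(G)` whose coefficients are right-translation invariant, the real
and imaginary parts of every coefficient are bounded by the standard trace. -/
theorem abs_re_im_coeff_le_trC {G : Type*} [Group G] [DecidableEq G]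
    (a : lp (fun _ : G => ℂ) 2 →L[ℂ] lp (fun _ : G => ℂ) 2)
    (hpos : ∀ ξ : lp (fun _ : G => ℂ) 2, 0 ≤ ⟪ξ, a ξ⟫_ℂ)
    (hcomm : ∀ s h t : G, ⟪delta t, a (delta (h * s))⟫_ℂ = ⟪delta (t * s⁻¹), a (delta h)⟫_ℂ)
    (h : G) :
    |(⟪delta h, a (delta (1 : G))⟫_ℂ).re| ≤ (trC a).re ∧
      |(⟪delta h, a (delta (1 : G))⟫_ℂ).im| ≤ (trC a).re := by
  have hdiag : ⟪delta h, a (delta h)⟫_ℂ = trC a := by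
    simpa [trC] using hcomm h 1 h
  have key : ∀ w : ℂ, 0 ≤ trC a + w * ⟪delta (1 : G), a (delta h)⟫_ℂ +
      (starRingEnd ℂ) w * (⟪delta h, a (delta (1 : G))⟫_ℂ + w * trC a) := by
    intro w
    have hw := hpos (delta 1 + w • delta h)
    simp only [map_add, map_smul, inner_add_left, inner_add_right, inner_smul_left,
      inner_smul_right, hdiag] at hw
    convert hw using 1
    simp only [trC]
    ring
  have h1 := Complex.nonneg_iff.1 (key 1)
  have h2 := Complex.nonneg_iff.1 (key (-1))
  have h3 := Complex.nonneg_iff.1 (key Complex.I)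
  have h4 := Complex.nonneg_iff.1 (key (-Complex.I))
  simp at h1 h2 h3 h4
  constructor <;> rw [abs_le] <;> constructor <;> linarith

/-- An additive map `ℂ →+ ℝ` that is bounded by `T` on each value of a finite family is bounded by
`T` on the average. -/
theorem abs_map_finsum_mem_div_ncard_le {ι : Type*} {s : Set ι} (hs : s.Finite)
    (L : ℂ →+ ℝ) (f : ι → ℂ) {T : ℝ} (hT : 0 ≤ T) (hf : ∀ i ∈ s, |L (f i)| ≤ T) :
    |L (∑ᶠ i ∈ s, f i)| / (s.ncard : ℝ) ≤ T := by
  refine div_le_of_le_mul₀ (Nat.cast_nonneg _) hT ?_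
  rw [finsum_mem_eq_finite_toFinset_sum _ hs, map_sum, Set.ncard_eq_toFinset_card _ hs]
  refine (Finset.abs_sum_le_sum_abs _ _).trans ?_
  rw [mul_comm, ← nsmul_eq_mul]
  exact Finset.sum_le_card_nsmul _ _ _ fun i hi => hf i (hs.mem_toFinset.1 hi)

theorem statement6 {G : Type*} [Group G] [DecidableEq G] (g : G)
    (hfin : (conjugatesOf g).Finite)
    (a : lp (fun _ : G => ℂ) 2 →L[ℂ] lp (fun _ : G => ℂ) 2)
    (hpos : ∀ ξ : lp (fun _ : G => ℂ) 2, 0 ≤ ⟪ξ, a ξ⟫_ℂ)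
    (hcomm : ∀ s h t : G, ⟪delta t, a (delta (h * s))⟫_ℂ = ⟪delta (t * s⁻¹), a (delta h)⟫_ℂ) :
    ((|(delocTrace g a).re| / ((conjugatesOf g).ncard : ℝ) : ℝ) : ℂ) ≤ trC a ∧
    ((|(delocTrace g a).im| / ((conjugatesOf g).ncard : ℝ) : ℝ) : ℂ) ≤ trC a := by
  have hcoeff := abs_re_im_coeff_le_trC a hpos hcomm
  have htr := Complex.nonneg_iff.1 (show 0 ≤ trC a from hpos (delta 1))
  refine ⟨Complex.le_def.2 ⟨?_, by simpa using htr.2⟩,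
    Complex.le_def.2 ⟨?_, by simpa using htr.2⟩⟩
  · exact abs_map_finsum_mem_div_ncard_le hfin Complex.reAddGroupHom _ htr.1
      fun h _ => (hcoeff h).1
  · exact abs_map_finsum_mem_div_ncard_le hfin Complex.imAddGroupHom _ htr.1
      fun h _ => (hcoeff h).2
end

section
/- Let $A$ be a nonzero $n \times n$ Hermitian positive semidefinite complex matrix whose characteristic polynomial has integer coefficients. Then the product of the nonzero eigenvalues of $A$ (counted with multiplicity) is a positive integer; in particular it is at least $1$. -/
/-!
STATEMENT 11.  Let `A` be a nonzero `n × n` Hermitian positive semidefinite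
complex matrix whose characteristic polynomial has integer coefficients.  Then
the product of the nonzero eigenvalues of `A` (counted with multiplicity) is a
positive integer; in particular it is at least `1`.

Positive semidefiniteness is expressed, as in the context, by all (real)
eigenvalues of the Hermitian matrix being nonnegative; the eigenvalues (with
multiplicity) are `hA.eigenvalues : Fin n → ℝ`.
-/

open Polynomial in
/-- The lowest nonzero coefficient of `∏ i ∈ s, (X - C (f i))` is, up to sign, the product of the
nonzero values of `f`. -/
theorem Polynomial.coeff_prod_X_sub_C_card_filter_eq_zero {R ι : Type*} [CommRing R]
    [DecidableEq R] (s : Finset ι) (f : ι → R) :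
    (∏ i ∈ s, (X - C (f i))).coeff (s.filter (fun i => f i = 0)).card =
      (-1) ^ (s.filter (fun i => f i ≠ 0)).card * ∏ i ∈ s.filter (fun i => f i ≠ 0), f i := by
  have hzero : ∏ i ∈ s.filter (fun i => f i = 0), (X - C (f i)) =
      X ^ (s.filter (fun i => f i = 0)).card := by
    rw [← Finset.prod_const]
    refine Finset.prod_congr rfl fun i hi => ?_
    rw [(Finset.mem_filter.mp hi).2, C_0, sub_zero]
  rw [← Finset.prod_filter_mul_prod_filter_not s (fun i => f i = 0), hzero,
    coeff_X_pow_mul', if_pos le_rfl, Nat.sub_self, coeff_zero_eq_eval_zero, eval_prod]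
  simp [Finset.prod_neg]

theorem statement11 {n : ℕ} (A : Matrix (Fin n) (Fin n) ℂ)
    (hA : A.IsHermitian)
    (hpsd : ∀ i, 0 ≤ hA.eigenvalues i)
    (hne : A ≠ 0)
    (hint : ∀ k, ∃ m : ℤ, A.charpoly.coeff k = (m : ℂ)) :
    (∃ m : ℤ, 0 < m ∧
        ∏ i ∈ Finset.univ.filter (fun i => hA.eigenvalues i ≠ 0), hA.eigenvalues i = (m : ℝ)) ∧
      1 ≤ ∏ i ∈ Finset.univ.filter (fun i => hA.eigenvalues i ≠ 0), hA.eigenvalues i := by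
  have hpos : 0 < ∏ i ∈ Finset.univ.filter (fun i => hA.eigenvalues i ≠ 0), hA.eigenvalues i :=
    Finset.prod_pos fun i hi => (hpsd i).lt_of_ne' (Finset.mem_filter.mp hi).2
  obtain ⟨m, hm, hprod⟩ : ∃ m : ℤ, 0 < m ∧
      ∏ i ∈ Finset.univ.filter (fun i => hA.eigenvalues i ≠ 0), hA.eigenvalues i = (m : ℝ) := by
    set s := Finset.univ.filter (fun i => hA.eigenvalues i ≠ 0)
    obtain ⟨m, hm⟩ := hint (Finset.univ.filter (fun i => hA.eigenvalues i = 0)).card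
    have hcharpoly : A.charpoly =
        (∏ i, (Polynomial.X - Polynomial.C (hA.eigenvalues i))).map Complex.ofRealHom := by
      simp [hA.charpoly_eq, Polynomial.map_prod]
    rw [hcharpoly, Polynomial.coeff_map,
      Polynomial.coeff_prod_X_sub_C_card_filter_eq_zero] at hm
    have hm' : (-1) ^ s.card * ∏ i ∈ s, hA.eigenvalues i = (m : ℝ) :=
      Complex.ofReal_injective (by simpa using hm)
    have hprod : ∏ i ∈ s, hA.eigenvalues i = (((-1) ^ s.card * m : ℤ) : ℝ) := by
      push_cast
      rw [← hm', ← mul_assoc, ← mul_pow]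
      simp
    exact ⟨_, by exact_mod_cast hprod ▸ hpos, hprod⟩
  refine ⟨⟨m, hm, hprod⟩, ?_⟩
  rw [hprod]
  exact_mod_cast hm
end

section
/- Let $K > 0$, $D > 0$ and $C \in \mathbb{R}$. Let $F : [0,K] \to [0,D]$ be monotone nondecreasing and let $(F_i)_{i\in\mathbb{N}}$ be a sequence of monotone nondecreasing functions $F_i : [0,K] \to [0,D]$ satisfying: (i) for every $\lambda \in [0,K)$, $\limsup_{i\to\infty} F_i(\lambda) \le F(\lambda) \le \inf_{\varepsilon > 0}\big(\liminf_{i\to\infty} F_i(\lambda+\varepsilon)\big)$ (where $\lambda + \varepsilon$ ranges in $[0,K]$); and (ii) for every $i$, $\int_{(0,K]} \frac{F_i(\lambda) - F_i(0)}{\lambda}\, d\lambda \le C$. Then the sequence $(F_i(0))_{i\in\mathbb{N}}$ converges and $\lim_{i\to\infty} F_i(0) = F(0)$. -/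
/-!
STATEMENT 14.  Let `K > 0`, `D > 0`, `C ∈ ℝ`.  Let `F : [0,K] → [0,D]` be
monotone nondecreasing and `(F_i)_{i ∈ ℕ}` a sequence of monotone nondecreasing
functions `F_i : [0,K] → [0,D]` such that
(i) for every `λ ∈ [0,K)`, `limsup_i F_i(λ) ≤ F(λ)` and
    `F(λ) ≤ liminf_i F_i(λ+ε)` for every `ε > 0` with `λ + ε ≤ K`
    (i.e. `F(λ)` is at most the infimum over such `ε` of the liminfs), and
(ii) for every `i`, `∫_{(0,K]} (F_i(λ) - F_i(0))/λ dλ ≤ C` (a Lebesgue integral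
     of a nonnegative integrand, formalized with `∫⁻` and `ENNReal.ofReal`).
Then `(F_i(0))_i` converges with limit `F(0)`.
-/

open MeasureTheory Filter

/-- A function exceeding `c` on `(x, K]` has integral at least `c * log (K / x)` against
the measure `dt / t`. -/
lemma ofReal_mul_log_div_le_lintegral {K x c : ℝ} {g : ℝ → ℝ} (hx : 0 < x) (hxK : x ≤ K)
    (hc : 0 ≤ c) (hg : ∀ t ∈ Set.Ioc x K, c ≤ g t) :
    ENNReal.ofReal (c * Real.log (K / x)) ≤
      ∫⁻ t in Set.Ioc (0 : ℝ) K, ENNReal.ofReal (g t / t) := by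
  have hK : 0 < K := hx.trans_le hxK
  have hi : IntervalIntegrable (fun t : ℝ => c * t⁻¹) volume x K := by
    refine (ContinuousOn.intervalIntegrable ?_)
    refine continuousOn_const.mul (continuousOn_id.inv₀ fun t ht => ?_)
    rw [Set.uIcc_of_le hxK] at ht
    exact (hx.trans_le ht.1).ne'
  have hval : ∫ t in Set.Ioc x K, c * t⁻¹ = c * Real.log (K / x) := by
    rw [← intervalIntegral.integral_of_le hxK, intervalIntegral.integral_const_mul,
      integral_inv_of_pos hx hK]
  calc ENNReal.ofReal (c * Real.log (K / x))
      = ∫⁻ t in Set.Ioc x K, ENNReal.ofReal (c * t⁻¹) := by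
        rw [← hval, ofReal_integral_eq_lintegral_ofReal
          ((intervalIntegrable_iff_integrableOn_Ioc_of_le hxK).1 hi)]
        filter_upwards [ae_restrict_mem measurableSet_Ioc] with t ht
        exact mul_nonneg hc (inv_nonneg.2 (hx.trans ht.1).le)
    _ ≤ ∫⁻ t in Set.Ioc x K, ENNReal.ofReal (g t / t) := by
        refine setLIntegral_mono' measurableSet_Ioc fun t ht => ENNReal.ofReal_le_ofReal ?_
        rw [div_eq_mul_inv]
        exact mul_le_mul_of_nonneg_right (hg t ht) (inv_nonneg.2 (hx.trans ht.1).le)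
    _ ≤ _ := lintegral_mono_set (Set.Ioc_subset_Ioc_left hx.le)

theorem statement14 (K D C : ℝ) (hK : 0 < K) (hD : 0 < D)
    (F : ℝ → ℝ) (Fi : ℕ → ℝ → ℝ)
    (hF : MonotoneOn F (Set.Icc 0 K))
    (hFrange : ∀ x ∈ Set.Icc (0 : ℝ) K, F x ∈ Set.Icc (0 : ℝ) D)
    (hFi : ∀ i, MonotoneOn (Fi i) (Set.Icc 0 K))
    (hFirange : ∀ i, ∀ x ∈ Set.Icc (0 : ℝ) K, Fi i x ∈ Set.Icc (0 : ℝ) D)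
    (hlimsup : ∀ lam ∈ Set.Ico (0 : ℝ) K,
      limsup (fun i => Fi i lam) atTop ≤ F lam)
    (hliminf : ∀ lam ∈ Set.Ico (0 : ℝ) K, ∀ ε > (0 : ℝ), lam + ε ≤ K →
      F lam ≤ liminf (fun i => Fi i (lam + ε)) atTop)
    (hint : ∀ i, ∫⁻ lam in Set.Ioc (0 : ℝ) K,
      ENNReal.ofReal ((Fi i lam - Fi i 0) / lam) ≤ ENNReal.ofReal C) :
    Tendsto (fun i => Fi i 0) atTop (nhds (F 0)) := by
  have h0 : (0 : ℝ) ∈ Set.Icc 0 K := ⟨le_rfl, hK.le⟩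
  have hbelow : ∀ x ∈ Set.Icc (0 : ℝ) K,
      IsBoundedUnder (· ≥ ·) atTop (fun i => Fi i x) := fun x hx =>
    isBoundedUnder_of ⟨0, fun i => (hFirange i x hx).1⟩
  have habove : ∀ x ∈ Set.Icc (0 : ℝ) K,
      IsBoundedUnder (· ≤ ·) atTop (fun i => Fi i x) := fun x hx =>
    isBoundedUnder_of ⟨D, fun i => (hFirange i x hx).2⟩
  refine tendsto_order.2 ⟨fun a ha => ?_, fun b hb =>
    eventually_lt_of_limsup_lt ((hlimsup 0 ⟨le_rfl, hK⟩).trans_lt hb) (habove 0 h0)⟩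
  obtain ⟨c, hac, hcF⟩ := exists_between ha
  have hδ : 0 < c - a := sub_pos.2 hac
  set M : ℝ := (max C 0 + 1) / (c - a)
  have hM : 0 < M := div_pos (by positivity) hδ
  set x : ℝ := K * Real.exp (-M)
  have hx : 0 < x := by positivity
  have hxK : x ≤ K := mul_le_of_le_one_right hK.le (Real.exp_le_one_iff.2 (by linarith))
  have hlog : Real.log (K / x) = M := by
    have : K / x = Real.exp M := by
      simp only [x, Real.exp_neg]
      field_simp
    rw [this, Real.log_exp]
  have hlim := hliminf 0 ⟨le_rfl, hK⟩ x hx (by simpa using hxK)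
  rw [zero_add] at hlim
  filter_upwards [eventually_lt_of_lt_liminf (hcF.trans_le hlim) (hbelow x ⟨hx.le, hxK⟩)]
    with i hi
  by_contra! hle
  have hbound := (ofReal_mul_log_div_le_lintegral (g := fun t => Fi i t - Fi i 0) hx hxK hδ.le
    fun t ht => by
      have := hFi i ⟨hx.le, hxK⟩ ⟨(hx.trans ht.1).le, ht.2⟩ ht.1.le
      linarith).trans (hint i)
  have hval : (c - a) * M = max C 0 + 1 := mul_div_cancel₀ _ hδ.ne'
  rw [hlog, hval] at hbound
  have hlt : ENNReal.ofReal C < ENNReal.ofReal (max C 0 + 1) :=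
    (ENNReal.ofReal_lt_ofReal_iff (by positivity)).2 (by linarith [le_max_left C 0])
  exact hbound.not_gt hlt
end
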